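/- arXiv:2206.14060 — 5 statements merged into one kernel-verified Lean document; each statement's English description precedes it below -/
import Mathlib

section
/- Let E be a real inner product space, C > 0, and let γ : [a,b] → E be a differentiable curve with ‖γ'(t)‖ = 1 for all t ∈ [a,b] and with γ' Lipschitz with constant C (i.e., ‖γ'(s) − γ'(t)‖ ≤ C·|s − t| for all s,t ∈ [a,b]). Then for all a ≤ t < s ≤ b one has ‖γ(s) − γ(t)‖ ≥ (s − t) − (C/2)(s − t)². -/
open InnerProductSpace

/-- Chord estimate: a unit speed curve whose derivative is Lipschitz with constant `C`
(i.e. whose curvature is bounded by `C`) satisfies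
`‖γ s - γ t‖ ≥ (s - t) - (C/2)(s - t)²` for `a ≤ t < s ≤ b`. -/
theorem chord_estimate {E : Type*} [NormedAddCommGroup E] [InnerProductSpace ℝ E]
    (C a b : ℝ) (hC : 0 < C) (γ γ' : ℝ → E)
    (hderiv : ∀ t ∈ Set.Icc a b, HasDerivAt γ (γ' t) t)
    (hunit : ∀ t ∈ Set.Icc a b, ‖γ' t‖ = 1)
    (hlip : ∀ s ∈ Set.Icc a b, ∀ t ∈ Set.Icc a b, ‖γ' s - γ' t‖ ≤ C * |s - t|) :
    ∀ t s : ℝ, a ≤ t → t < s → s ≤ b →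
      ‖γ s - γ t‖ ≥ (s - t) - C / 2 * (s - t) ^ 2 := by
  intro t s hat hts hsb
  have mem : ∀ x ∈ Set.Icc t s, x ∈ Set.Icc a b := fun x hx =>
    ⟨hat.trans hx.1, hx.2.trans hsb⟩
  have ht : t ∈ Set.Icc a b := mem t ⟨le_rfl, hts.le⟩
  have hf : ∀ x ∈ Set.Icc t s,
      HasDerivAt (fun x => γ x - γ t - (x - t) • γ' t) (γ' x - γ' t) x := by
    intro x hx
    simpa using ((hderiv x (mem x hx)).sub_const (γ t)).fun_sub
      (((hasDerivAt_id x).sub_const t).smul_const (γ' t))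
  have hB : ∀ x, HasDerivAt (fun x => C / 2 * (x - t) ^ 2) (C * (x - t)) x := by
    intro x
    refine ((((hasDerivAt_id' x).sub_const t).fun_pow 2).const_mul (C / 2)).congr_deriv ?_
    norm_num
    ring
  have taylor : ‖γ s - γ t - (s - t) • γ' t‖ ≤ C / 2 * (s - t) ^ 2 := by
    refine image_norm_le_of_norm_deriv_right_le_deriv_boundary
      (fun x hx => (hf x hx).continuousAt.continuousWithinAt)
      (fun x hx => (hf x (Set.Ico_subset_Icc_self hx)).hasDerivWithinAt)
      (by simp) hB (fun x hx => ?_) (Set.right_mem_Icc.2 hts.le)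
    simpa [abs_of_nonneg (sub_nonneg.2 hx.1)] using
      hlip x (mem x (Set.Ico_subset_Icc_self hx)) t ht
  have tangent : ‖(s - t) • γ' t‖ = s - t := by
    rw [norm_smul, hunit t ht, mul_one, Real.norm_of_nonneg (sub_nonneg.2 hts.le)]
  have := norm_sub_norm_le ((s - t) • γ' t) (γ s - γ t)
  rw [norm_sub_rev ((s - t) • γ' t), tangent] at this
  linarith
end

section
/- Let E be a real inner product space, C > 0, and let γ : [a,b] → E be a differentiable curve with ‖γ'(t)‖ = 1 for all t ∈ [a,b] and with γ' Lipschitz with constant C (i.e., ‖γ'(s) − γ'(t)‖ ≤ C·|s − t| for all s,t ∈ [a,b]). If b − a < 2/C, then γ is injective; in particular this holds if b − a ≤ 1/(10·C). -/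
open InnerProductSpace

/-- A unit speed curve with derivative Lipschitz with constant `C` (curvature bounded by `C`)
defined on an interval of length less than `2 / C` is injective; in particular this holds
when `b - a ≤ 1 / (10 * C)`. -/
theorem short_curve_injective {E : Type*} [NormedAddCommGroup E] [InnerProductSpace ℝ E]
    (C a b : ℝ) (hC : 0 < C) (γ γ' : ℝ → E)
    (hderiv : ∀ t ∈ Set.Icc a b, HasDerivAt γ (γ' t) t)
    (hunit : ∀ t ∈ Set.Icc a b, ‖γ' t‖ = 1)
    (hlip : ∀ s ∈ Set.Icc a b, ∀ t ∈ Set.Icc a b, ‖γ' s - γ' t‖ ≤ C * |s - t|)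
    (hshort : b - a < 2 / C) :
    Set.InjOn γ (Set.Icc a b) := by
  have no_return : ∀ s ∈ Set.Icc a b, ∀ t ∈ Set.Icc a b, s < t → γ s ≠ γ t := by
    intro s hs t ht hst heq
    have hsub : ∀ x ∈ Set.Icc s t, x ∈ Set.Icc a b := fun x hx =>
      ⟨hs.1.trans hx.1, hx.2.trans ht.2⟩
    have hm : (s + t) / 2 ∈ Set.Icc a b := hsub _ ⟨by linarith, by linarith⟩
    have hd : ∀ x ∈ Set.Icc s t,
        HasDerivAt (fun y => inner ℝ (γ' ((s + t) / 2)) (γ y))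
          (inner ℝ (γ' ((s + t) / 2)) (γ' x)) x := fun x hx => by
      simpa using (hasDerivAt_const x (γ' ((s + t) / 2))).inner ℝ (hderiv x (hsub x hx))
    obtain ⟨x, hx, hx0⟩ := exists_hasDerivAt_eq_zero hst
      (fun x hx => (hd x hx).continuousAt.continuousWithinAt) (by simp only [heq])
      (fun x hx => hd x (Set.Ioo_subset_Icc_self hx))
    have hxab := hsub x (Set.Ioo_subset_Icc_self hx)
    have hclose : ‖γ' ((s + t) / 2) - γ' x‖ < 1 := by
      refine (hlip _ hm x hxab).trans_lt ?_
      have habs : |(s + t) / 2 - x| ≤ (b - a) / 2 :=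
        abs_le.2 ⟨by linarith [hx.2, hs.1, ht.2], by linarith [hx.1, hs.1, ht.2]⟩
      have hlen := (lt_div_iff₀ hC).1 hshort
      nlinarith
    have hsq := norm_sub_sq_real (γ' ((s + t) / 2)) (γ' x)
    rw [hx0, hunit _ hm, hunit x hxab] at hsq
    nlinarith [norm_nonneg (γ' ((s + t) / 2) - γ' x)]
  intro s hs t ht heq
  rcases lt_trichotomy s t with h | h | h
  · exact absurd heq (no_return s hs t ht h)
  · exact h
  · exact absurd heq.symm (no_return t ht s hs h)
end

section
/- Let E be a real inner product space, let S ⊆ E, let x ∈ S, let ν ∈ E be a unit vector and let κ > 0. Then the following are equivalent: (i) for every y ∈ S with y ≠ x one has Z(x, y, ν) ≤ κ; (ii) for every y ∈ S one has ‖y − (x − κ⁻¹·ν)‖ ≥ κ⁻¹, i.e. the open ball of radius κ⁻¹ centred at x − κ⁻¹·ν (the interior of the inscribed sphere of curvature κ tangent at x) contains no point of S. -/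
open InnerProductSpace

/-- A point `y` lies outside the open ball of radius `κ⁻¹` tangent at `x` with outward unit
normal `ν` iff `2⟪x - y, ν⟫ ≤ κ‖x - y‖²`. -/
theorem inv_le_norm_sub_tangent_center_iff {E : Type*} [NormedAddCommGroup E]
    [InnerProductSpace ℝ E] (x y : E) {ν : E} (hν : ‖ν‖ = 1) {κ : ℝ} (hκ : 0 < κ) :
    κ⁻¹ ≤ ‖y - (x - κ⁻¹ • ν)‖ ↔ 2 * ⟪x - y, ν⟫_ℝ ≤ κ * ‖x - y‖ ^ 2 := by
  have hnorm : ‖y - (x - κ⁻¹ • ν)‖ ^ 2 =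
      κ⁻¹ ^ 2 + κ⁻¹ * (κ * ‖x - y‖ ^ 2 - 2 * ⟪x - y, ν⟫_ℝ) := by
    rw [show y - (x - κ⁻¹ • ν) = -((x - y) - κ⁻¹ • ν) by abel, norm_neg, norm_sub_sq_real,
      real_inner_smul_right, norm_smul, hν, Real.norm_of_nonneg (inv_pos.2 hκ).le]
    field_simp
    ring
  rw [← sq_le_sq₀ (inv_pos.2 hκ).le (norm_nonneg _), hnorm, le_add_iff_nonneg_right,
    mul_nonneg_iff_of_pos_left (inv_pos.2 hκ), sub_nonneg]

/-- Inner noncollapsing characterisation (Lemma 3.4): for `x ∈ S`, a unit vector `ν` and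
`κ > 0`, the double point function `Z(x, y, ν) = 2⟪x - y, ν⟫ / ‖x - y‖²` is at most `κ` for
all `y ∈ S \ {x}` if and only if the open ball of radius `κ⁻¹` centred at `x - κ⁻¹ • ν`
(the interior of the inscribed tangent sphere of curvature `κ` at `x`) contains no point
of `S`. -/
theorem inner_sphere_iff_Z_le {E : Type*} [NormedAddCommGroup E]
    [InnerProductSpace ℝ E] (S : Set E) (x ν : E) (hx : x ∈ S) (hν : ‖ν‖ = 1)
    (κ : ℝ) (hκ : 0 < κ) :
    (∀ y ∈ S, y ≠ x → 2 * ⟪x - y, ν⟫_ℝ / ‖x - y‖ ^ 2 ≤ κ) ↔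
      (∀ y ∈ S, ‖y - (x - κ⁻¹ • ν)‖ ≥ κ⁻¹) := by
  refine forall₂_congr fun y _ => ?_
  rw [ge_iff_le, inv_le_norm_sub_tangent_center_iff x y hν hκ]
  rcases eq_or_ne y x with rfl | hyx
  · simp
  · have hpos : 0 < ‖x - y‖ ^ 2 := by
      have := norm_pos_iff.2 (sub_ne_zero.2 hyx.symm)
      positivity
    simp only [hyx, ne_eq, not_false_eq_true, forall_const, div_le_iff₀ hpos]
end

section
/- Let E be a real inner product space, let S ⊆ E, let x ∈ S, let ν ∈ E be a unit vector and let κ > 0. Then the following are equivalent: (i) for every y ∈ S with y ≠ x one has Z(x, y, ν) ≥ −κ; (ii) for every y ∈ S one has ‖y − (x + κ⁻¹·ν)‖ ≥ κ⁻¹, i.e. the open ball of radius κ⁻¹ centred at x + κ⁻¹·ν (the interior of the exterior tangent sphere of curvature κ at x) contains no point of S. -/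
open InnerProductSpace

/-- A point `y` lies outside the open ball of radius `κ⁻¹` tangent at `x` with inner direction `ν`
if and only if `-κ ‖x - y‖² ≤ 2⟪x - y, ν⟫`. -/
lemma inv_le_norm_sub_add_inv_smul_iff {E : Type*} [NormedAddCommGroup E]
    [InnerProductSpace ℝ E] (x y ν : E) (hν : ‖ν‖ = 1) {κ : ℝ} (hκ : 0 < κ) :
    κ⁻¹ ≤ ‖y - (x + κ⁻¹ • ν)‖ ↔ -κ * ‖x - y‖ ^ 2 ≤ 2 * ⟪x - y, ν⟫_ℝ := by
  have hnorm : ‖y - (x + κ⁻¹ • ν)‖ ^ 2 =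
      (κ⁻¹) ^ 2 + κ⁻¹ * (κ * ‖x - y‖ ^ 2 + 2 * ⟪x - y, ν⟫_ℝ) := by
    rw [← norm_neg, show -(y - (x + κ⁻¹ • ν)) = (x - y) + κ⁻¹ • ν by abel,
      norm_add_sq_real, inner_smul_right, norm_smul, hν, Real.norm_of_nonneg (by positivity),
      mul_add, inv_mul_cancel_left₀ hκ.ne']
    ring
  rw [← pow_le_pow_iff_left₀ (by positivity) (norm_nonneg _) two_ne_zero, hnorm,
    le_add_iff_nonneg_right, mul_nonneg_iff_of_pos_left (inv_pos.2 hκ), neg_mul,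
    neg_le_iff_add_nonneg']

/-- Outer noncollapsing characterisation: for `x ∈ S`, a unit vector `ν` and `κ > 0`, the
double point function `Z(x, y, ν) = 2⟪x - y, ν⟫ / ‖x - y‖²` is at least `-κ` for all
`y ∈ S \ {x}` if and only if the open ball of radius `κ⁻¹` centred at `x + κ⁻¹ • ν`
(the interior of the exterior tangent sphere of curvature `κ` at `x`) contains no point
of `S`. -/
theorem outer_sphere_iff_Z_ge {E : Type*} [NormedAddCommGroup E]
    [InnerProductSpace ℝ E] (S : Set E) (x ν : E) (hx : x ∈ S) (hν : ‖ν‖ = 1)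
    (κ : ℝ) (hκ : 0 < κ) :
    (∀ y ∈ S, y ≠ x → 2 * ⟪x - y, ν⟫_ℝ / ‖x - y‖ ^ 2 ≥ -κ) ↔
      (∀ y ∈ S, ‖y - (x + κ⁻¹ • ν)‖ ≥ κ⁻¹) := by
  simp only [ge_iff_le, inv_le_norm_sub_add_inv_smul_iff x _ ν hν hκ]
  refine forall₂_congr fun y _ => ?_
  rcases eq_or_ne y x with rfl | hyx
  · simp
  · have hpos : 0 < ‖x - y‖ ^ 2 := pow_pos (norm_pos_iff.2 (sub_ne_zero.2 hyx.symm)) 2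
    simp only [ne_eq, hyx, not_false_eq_true, forall_const, le_div_iff₀ hpos]
end

section
/- Let E be a real inner product space, let ν, w ∈ E be unit vectors, set a := ⟨w, ν⟩ and assume |a| < 1. Define e := (w − a·ν)/√(1 − a²) and f := −((1 − 2a²)·w + a·ν)/√(1 − a²). Then 1 − ⟨f, e⟩ + 2·⟨w, e⟩·⟨w, f − e⟩ = −2(1 − a²); in particular this quantity is strictly negative. -/
open InnerProductSpace

/-- Key sign computation (following Lemma 6 of Andrews–Langford–McCoy): for unit vectors
`ν, w` with `a = ⟪w, ν⟫`, `|a| < 1`, and the tangent directions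
`e = (w - a ν)/√(1 - a²)`, `f = -((1 - 2a²) w + a ν)/√(1 - a²)`, one has
`1 - ⟪f, e⟫ + 2⟪w, e⟫⟪w, f - e⟫ = -2(1 - a²) < 0`. -/
theorem tangent_directions_sign {E : Type*} [NormedAddCommGroup E]
    [InnerProductSpace ℝ E] (ν w : E) (hν : ‖ν‖ = 1) (hw : ‖w‖ = 1)
    (a : ℝ) (ha : a = ⟪w, ν⟫_ℝ) (ha1 : |a| < 1)
    (e f : E)
    (he : e = (Real.sqrt (1 - a ^ 2))⁻¹ • (w - a • ν))
    (hf : f = -((Real.sqrt (1 - a ^ 2))⁻¹ • ((1 - 2 * a ^ 2) • w + a • ν))) :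
    1 - ⟪f, e⟫_ℝ + 2 * ⟪w, e⟫_ℝ * ⟪w, f - e⟫_ℝ = -2 * (1 - a ^ 2) ∧
      1 - ⟪f, e⟫_ℝ + 2 * ⟪w, e⟫_ℝ * ⟪w, f - e⟫_ℝ < 0 := by
  have hpos : 0 < 1 - a ^ 2 := by
    have := (sq_lt_one_iff_abs_lt_one a).2 ha1
    linarith
  have ht : (Real.sqrt (1 - a ^ 2))⁻¹ ^ 2 * (1 - a ^ 2) = 1 := by
    rw [inv_pow, Real.sq_sqrt hpos.le, inv_mul_cancel₀ hpos.ne']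
  generalize (Real.sqrt (1 - a ^ 2))⁻¹ = t at he hf ht
  have hww : ⟪w, w⟫_ℝ = 1 := by simp [hw]
  have hwν : ⟪w, ν⟫_ℝ = a := ha.symm
  have hνw : ⟪ν, w⟫_ℝ = a := by rw [real_inner_comm, hwν]
  have hνν : ⟪ν, ν⟫_ℝ = 1 := by simp [hν]
  have hwe : ⟪w, e⟫_ℝ = t * (1 - a ^ 2) := by
    rw [he, inner_smul_right, inner_sub_right, inner_smul_right, hww, hwν]
    ring
  have hwf : ⟪w, f⟫_ℝ = -(t * (1 - a ^ 2)) := by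
    rw [hf, inner_neg_right, inner_smul_right, inner_add_right, inner_smul_right,
      inner_smul_right, hww, hwν]
    ring
  have hνe : ⟪ν, e⟫_ℝ = 0 := by
    rw [he, inner_smul_right, inner_sub_right, inner_smul_right, hνw, hνν]
    ring
  have hfe : ⟪f, e⟫_ℝ = -(1 - 2 * a ^ 2) := by
    rw [hf, inner_neg_left, real_inner_smul_left, inner_add_left, real_inner_smul_left,
      real_inner_smul_left, hwe, hνe]
    linear_combination -(1 - 2 * a ^ 2) * ht
  have key : 1 - ⟪f, e⟫_ℝ + 2 * ⟪w, e⟫_ℝ * ⟪w, f - e⟫_ℝ = -2 * (1 - a ^ 2) := by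
    rw [inner_sub_right, hfe, hwe, hwf]
    linear_combination -4 * (1 - a ^ 2) * ht
  exact ⟨key, by rw [key]; linarith⟩
end
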